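/- arXiv:math/9802017 — 2 statements merged into one kernel-verified Lean document; each statement's English description precedes it below -/
import Mathlib

section
/- Let G be a finite group and φ : G → G an endomorphism. Then R(φ) equals the number of irreducible complex characters χ of G satisfying χ ∘ φ = χ. -/
/-- Two elements `a`, `b` of a group are `φ`-conjugate if `b = γ * a * (φ γ)⁻¹` for some `γ`. -/
def phiConj {G : Type*} [Group G] (φ : G → G) (a b : G) : Prop :=
  ∃ γ : G, b = γ * a * (φ γ)⁻¹

/-- The Reidemeister number of `φ`: the number of `φ`-conjugacy classes
(`0` if there are infinitely many). -/
noncomputable def reidemeisterNumber {G : Type*} [Group G] (φ : G → G) : ℕ :=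
  Nat.card (Quot (phiConj φ))

section ClassFunctions

variable {G : Type*} [Group G] [Fintype G]

/-- The element `∑ g, f g • g⁻¹` of the group algebra. -/
noncomputable def invSum (f : G → ℂ) : MonoidAlgebra ℂ G :=
  ∑ g, MonoidAlgebra.single g⁻¹ (f g)

theorem invSum_commute_of {f : G → ℂ} (hf : ∀ g h, f (h * g * h⁻¹) = f g) (h : G) :
    Commute (invSum f) (MonoidAlgebra.of ℂ G h) := by
  simp only [Commute, SemiconjBy, invSum, Finset.sum_mul, Finset.mul_sum, MonoidAlgebra.of_apply,
    MonoidAlgebra.single_mul_single, mul_one, one_mul]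
  refine Fintype.sum_equiv (MulAut.conj h⁻¹).toEquiv _ _ fun g => ?_
  have : f (h⁻¹ * g * h⁻¹⁻¹) = f g := hf g h⁻¹
  simp only [MulEquiv.toEquiv_eq_coe, MulEquiv.coe_toEquiv, MulAut.conj_apply, this]
  congr 1
  group

theorem invSum_commute {f : G → ℂ} (hf : ∀ g h, f (h * g * h⁻¹) = f g)
    (a : MonoidAlgebra ℂ G) : Commute (invSum f) a := by
  induction a using MonoidAlgebra.induction_on with
  | of g => exact invSum_commute_of hf g
  | add a b ha hb => exact ha.add_right hb
  | smul r a ha => exact ha.smul_right r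

theorem invSum_eq_zero {f : G → ℂ} (h : invSum f = 0) : f = 0 := by
  classical
  funext g
  have := congrArg (fun a : MonoidAlgebra ℂ G => a.coeff g⁻¹) h
  simpa [invSum, Finsupp.single_apply] using this

/-- By Schur's lemma, a class function orthogonal to the character of an irreducible
representation acts on it by zero. -/
theorem asAlgebraHom_invSum_eq_zero {V : Type*} [AddCommGroup V] [Module ℂ V]
    [FiniteDimensional ℂ V] (ρ : Representation ℂ G V) [ρ.IsIrreducible] {f : G → ℂ}
    (hf : ∀ g h, f (h * g * h⁻¹) = f g) (horth : ∑ g, f g * ρ.character g⁻¹ = 0) :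
    ρ.asAlgebraHom (invSum f) = 0 := by
  let T : Representation.IntertwiningMap ρ ρ :=
    { toLinearMap := ρ.asAlgebraHom (invSum f)
      isIntertwining' := fun h => by
        have := congrArg ρ.asAlgebraHom (invSum_commute_of hf h).eq
        rw [map_mul, map_mul, Representation.asAlgebraHom_of] at this
        exact this }
  obtain ⟨c, hc⟩ :=
    (Representation.IsIrreducible.algebraMap_intertwiningMap_bijective_of_isAlgClosed (ρ := ρ)).2 T
  have hT : ρ.asAlgebraHom (invSum f) = c • LinearMap.id := by
    have := congrArg (fun S => S.toLinearMap) hc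
    exact this.symm
  have htr : LinearMap.trace ℂ V (ρ.asAlgebraHom (invSum f)) = 0 := by
    rw [← horth]
    simp [invSum, Representation.character, Representation.asAlgebraHom_single]
  rw [hT] at htr ⊢
  have hnt : Nontrivial V := by
    by_contra hV
    rw [not_nontrivial_iff_subsingleton] at hV
    have h1 := Representation.IsIrreducible.finrank_intertwiningMap_self ρ
    have : Subsingleton (Representation.IntertwiningMap ρ ρ) :=
      ⟨fun a b => Representation.IntertwiningMap.ext (Subsingleton.elim _ _)⟩
    rw [Module.finrank_zero_of_subsingleton] at h1
    exact zero_ne_one h1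
  have hd : (Module.finrank ℂ V : ℂ) ≠ 0 := by exact_mod_cast Module.finrank_pos.ne'
  rw [map_smul, LinearMap.trace_id, smul_eq_mul] at htr
  rw [(mul_eq_zero.mp htr).resolve_right hd, zero_smul]

end ClassFunctions

section Characters

variable {G : Type} [Group G] [Fintype G]

theorem FDRep.simple_of_isIrreducible {V : Type} [AddCommGroup V] [Module ℂ V]
    [FiniteDimensional ℂ V] (ρ : Representation ℂ G V) [ρ.IsIrreducible] :
    CategoryTheory.Simple (FDRep.of ρ) := by
  have := invertibleOfNonzero (NeZero.ne (Nat.card G : ℂ))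
  rw [FDRep.simple_iff_char_is_norm_one]
  have h := Representation.char_orthonormal ρ ρ
  rw [if_pos ⟨Representation.Equiv.refl ρ⟩, inv_mul_eq_one₀ (NeZero.ne _)] at h
  exact h.symm

theorem invSum_smul_eq_zero (M : Type) [AddCommGroup M] [Module ℂ M]
    [Module (MonoidAlgebra ℂ G) M] [IsScalarTower ℂ (MonoidAlgebra ℂ G) M]
    [hM : IsSimpleModule (MonoidAlgebra ℂ G) M] {f : G → ℂ} (hf : ∀ g h, f (h * g * h⁻¹) = f g)
    (horth : ∀ V : FDRep ℂ G, CategoryTheory.Simple V → ∑ g, f g * V.character g⁻¹ = 0) (x : M) :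
    invSum f • x = 0 := by
  have : FiniteDimensional ℂ M := Module.Finite.trans (MonoidAlgebra ℂ G) M
  let ρ : Representation ℂ G M := Representation.ofModule' M
  have hρ (a : MonoidAlgebra ℂ G) (y : M) : ρ.asAlgebraHom a y = a • y := by
    simp [ρ, Representation.asAlgebraHom, Representation.ofModule']
  let e : ρ.asModule ≃ₗ[MonoidAlgebra ℂ G] M :=
    { ρ.asModuleEquiv.toAddEquiv with
      map_smul' := fun a y => hρ a (ρ.asModuleEquiv y) }
  have : ρ.IsIrreducible :=
    (Representation.irreducible_iff_isSimpleModule_asModule ρ).mpr (IsSimpleModule.congr e)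
  rw [← hρ, asAlgebraHom_invSum_eq_zero ρ hf
    (horth (FDRep.of ρ) (FDRep.simple_of_isIrreducible ρ)), LinearMap.zero_apply]

/-- A class function orthogonal to all irreducible characters vanishes. -/
theorem classFunction_eq_zero {f : G → ℂ} (hf : ∀ g h, f (h * g * h⁻¹) = f g)
    (horth : ∀ V : FDRep ℂ G, CategoryTheory.Simple V → ∑ g, f g * V.character g⁻¹ = 0) :
    f = 0 := by
  apply invSum_eq_zero
  have htop : (⊤ : Submodule (MonoidAlgebra ℂ G) (MonoidAlgebra ℂ G)) ≤
      LinearMap.ker (LinearMap.toSpanSingleton (MonoidAlgebra ℂ G) _ (invSum f)) := by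
    rw [← IsSemisimpleModule.sSup_simples_eq_top]
    refine sSup_le fun m (hm : IsSimpleModule _ m) x hx => ?_
    have h2 := invSum_smul_eq_zero m hf horth ⟨x, hx⟩
    have h3 : invSum f * x = 0 := congrArg Subtype.val h2
    simpa [LinearMap.mem_ker, LinearMap.toSpanSingleton_apply, ← (invSum_commute hf x).eq] using h3
  simpa using htop (Submodule.mem_top (x := 1))

/-- The irreducible complex characters of `G`. -/
abbrev IrrChar (G : Type) [Group G] : Type :=
  {χ : G → ℂ // ∃ V : FDRep ℂ G, CategoryTheory.Simple V ∧ V.character = χ}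

open scoped Classical in
theorem IrrChar.orthogonality (χ ψ : IrrChar G) :
    ∑ g, χ.1 g * ψ.1 g⁻¹ = if χ = ψ then (Nat.card G : ℂ) else 0 := by
  have := invertibleOfNonzero (NeZero.ne (Nat.card G : ℂ))
  obtain ⟨_, V, hV, rfl⟩ := χ
  obtain ⟨_, W, hW, rfl⟩ := ψ
  split_ifs with h
  · have h' : V.character = W.character := congrArg Subtype.val h
    simp only [← h']
    exact (FDRep.simple_iff_char_is_norm_one V).mp hV
  · have h1 := FDRep.char_orthonormal V W
    rw [if_neg fun ⟨i⟩ => h (Subtype.ext (FDRep.char_iso i))] at h1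
    exact (mul_eq_zero.mp h1).resolve_left (inv_ne_zero (NeZero.ne _))

instance IrrChar.finite : Finite (IrrChar G) := by
  classical
  have hli : LinearIndependent ℂ (fun χ : IrrChar G => χ.1) := by
    rw [linearIndependent_iff']
    intro s c hc ψ hψ
    have h1 : ∑ g, (∑ χ ∈ s, c χ • χ.1) g * ψ.1 g⁻¹ = 0 := by
      simp only [hc, Pi.zero_apply, zero_mul, Finset.sum_const_zero]
    simp only [Finset.sum_apply, Pi.smul_apply, smul_eq_mul, Finset.sum_mul, mul_assoc] at h1
    rw [Finset.sum_comm] at h1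
    simpa [← Finset.mul_sum, IrrChar.orthogonality, hψ] using h1
  exact hli.finite_of_isNoetherian

omit [Fintype G] in
theorem IrrChar.apply_conj (χ : IrrChar G) (g h : G) : χ.1 (h * g * h⁻¹) = χ.1 g := by
  obtain ⟨_, V, -, rfl⟩ := χ
  exact V.char_conj g h

/-- Column orthogonality of the character table. -/
theorem IrrChar.sum_mul_inv [Fintype (IrrChar G)] [DecidableEq G] (x y : G) :
    ∑ χ : IrrChar G, χ.1 x * χ.1 y⁻¹ =
      ((Finset.univ.filter fun a : G => a * x * a⁻¹ = y).card : ℂ) := by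
  classical
  let f : G → ℂ := fun x => ((Finset.univ.filter fun a : G => a * x * a⁻¹ = y).card : ℂ) -
    ∑ χ : IrrChar G, χ.1 x * χ.1 y⁻¹
  suffices f = 0 from (sub_eq_zero.mp (congrFun this x)).symm
  refine classFunction_eq_zero (fun g h => ?_) fun V hV => ?_
  · simp only [f, IrrChar.apply_conj]
    congr 2
    refine Finset.card_equiv (Equiv.mulRight h) fun a => ?_
    simp [mul_assoc]
  · let ψ : IrrChar G := ⟨_, V, hV, rfl⟩
    change ∑ g, f g * ψ.1 g⁻¹ = 0
    have h1 : ∑ g, ((Finset.univ.filter fun a : G => a * g * a⁻¹ = y).card : ℂ) * ψ.1 g⁻¹ =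
        Nat.card G * ψ.1 y⁻¹ := by
      simp only [Finset.card_filter, Nat.cast_sum, Finset.sum_mul]
      rw [Finset.sum_comm]
      have : ∀ a : G, ∑ g, ((if a * g * a⁻¹ = y then 1 else 0 : ℕ) : ℂ) * ψ.1 g⁻¹ = ψ.1 y⁻¹ := by
        intro a
        rw [Finset.sum_eq_single (a⁻¹ * y * a)]
        · rw [if_pos (by group), Nat.cast_one, one_mul, ← ψ.apply_conj _ a]
          group
        · intro b _ hb
          rw [if_neg, Nat.cast_zero, zero_mul]
          rintro rfl
          exact hb (by group)
        · simp
      simp only [this, Finset.sum_const, Finset.card_univ, nsmul_eq_mul, Nat.card_eq_fintype_card]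
    have h2 : ∑ g, (∑ χ : IrrChar G, χ.1 g * χ.1 y⁻¹) * ψ.1 g⁻¹ = Nat.card G * ψ.1 y⁻¹ := by
      simp only [Finset.sum_mul, mul_right_comm _ (_ : ℂ) (ψ.1 _)]
      rw [Finset.sum_comm]
      simp only [← Finset.sum_mul, IrrChar.orthogonality, ite_mul, zero_mul, Finset.sum_ite_eq',
        Finset.mem_univ, if_true]
    simp only [f, sub_mul, Finset.sum_sub_distrib, h1, h2, sub_self]

omit [Fintype G] in
/-- A nonzero morphism from a simple representation to one of the same dimension
forces the characters to agree. -/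
theorem FDRep.character_eq_of_ne_zero {V W : FDRep ℂ G} [CategoryTheory.Simple V] (f : V ⟶ W)
    (hf : f ≠ 0) (hd : Module.finrank ℂ V = Module.finrank ℂ W) :
    V.character = W.character := by
  have hm : CategoryTheory.Mono f := CategoryTheory.mono_of_nonzero_from_simple hf
  let F := CategoryTheory.forget₂ (FDRep ℂ G) (Rep ℂ G)
  have hinj : Function.Injective (F.map f).hom := (Rep.mono_iff_injective _).mp inferInstance
  let l : Representation.IntertwiningMap V.ρ W.ρ :=
    { toLinearMap := (F.map f).hom.toLinearMap
      isIntertwining' := (F.map f).hom.isIntertwining' }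
  exact Representation.char_iso
    (l.ofBijective ⟨hinj, (LinearMap.injective_iff_surjective_of_finrank_eq_finrank hd).mp hinj⟩)

open scoped Classical in
theorem IrrChar.sum_comp_mul_inv (χ : IrrChar G) (φ : G →* G) :
    ∑ g, χ.1 (φ g) * χ.1 g⁻¹ = if χ.1 ∘ φ = χ.1 then (Nat.card G : ℂ) else 0 := by
  have := invertibleOfNonzero (NeZero.ne (Nat.card G : ℂ))
  split_ifs with h
  · have := IrrChar.orthogonality χ χ
    rw [if_pos rfl] at this
    rw [← this]
    exact Finset.sum_congr rfl fun g _ => by rw [← congrFun h g]; rfl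
  · obtain ⟨_, V, hV, rfl⟩ := χ
    let W : FDRep ℂ G := FDRep.of (V.ρ.comp φ)
    have h1 := FDRep.scalar_product_char_eq_finrank_equivariant V W
    have h2 : Module.finrank ℂ (V ⟶ W) = 0 := by
      by_contra hne
      have : Nontrivial (V ⟶ W) := Module.nontrivial_of_finrank_pos (Nat.pos_of_ne_zero hne)
      obtain ⟨f, hf⟩ := exists_ne (0 : V ⟶ W)
      exact h (FDRep.character_eq_of_ne_zero f hf rfl).symm
    rw [h2, Nat.cast_zero] at h1
    exact (mul_eq_zero.mp h1).resolve_left (inv_ne_zero (NeZero.ne _))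

end Characters

section Reidemeister

/-- A copy of `G`, on which `G` acts by `φ`-conjugation. -/
def PhiConjSpace {G : Type*} [Group G] (_φ : G →* G) : Type _ := G

variable {G : Type*} [Group G]

instance (φ : G →* G) : MulAction G (PhiConjSpace φ) where
  smul γ a := (γ * (show G from a) * (φ γ)⁻¹ : G)
  one_smul a := by
    change (1 * (show G from a) * (φ 1)⁻¹ : G) = (show G from a)
    rw [map_one, inv_one, mul_one, one_mul]
  mul_smul γ δ a := by
    have key (b : G) : γ * δ * b * (φ (γ * δ))⁻¹ = γ * (δ * b * (φ δ)⁻¹) * (φ γ)⁻¹ := by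
      rw [map_mul]
      group
    exact key a

/-- Burnside's lemma for `φ`-conjugacy. -/
theorem reidemeisterNumber_mul_card [Fintype G] [DecidableEq G] (φ : G →* G) :
    reidemeisterNumber φ * Nat.card G =
      ∑ γ : G, (Finset.univ.filter fun a : G => a * φ γ * a⁻¹ = γ).card := by
  classical
  have : Fintype (PhiConjSpace φ) := inferInstanceAs (Fintype G)
  have hq : reidemeisterNumber φ =
      Nat.card (Quotient (MulAction.orbitRel G (PhiConjSpace φ))) := by
    refine Nat.card_congr (Quot.congr (show G ≃ PhiConjSpace φ from Equiv.refl G) fun a b => ?_)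
    change (∃ γ : G, b = γ * a * (φ γ)⁻¹) ↔
      ∃ γ : G, (γ * b * (φ γ)⁻¹ : G) = a
    constructor
    · rintro ⟨γ, rfl⟩
      exact ⟨γ⁻¹, by rw [map_inv]; group⟩
    · rintro ⟨γ, rfl⟩
      exact ⟨γ⁻¹, by rw [map_inv]; group⟩
  rw [hq, Nat.card_eq_fintype_card, Nat.card_eq_fintype_card,
    ← MulAction.sum_card_fixedBy_eq_card_orbits_mul_card_group]
  refine Finset.sum_congr rfl fun γ _ => ?_
  rw [← Fintype.card_subtype]
  refine Fintype.card_congr (Equiv.subtypeEquiv (show PhiConjSpace φ ≃ G from Equiv.refl G)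
    fun a => ?_)
  change (γ * (show G from a) * (φ γ)⁻¹ : G) = (show G from a) ↔
    (show G from a) * φ γ * (show G from a)⁻¹ = γ
  rw [mul_inv_eq_iff_eq_mul, mul_inv_eq_iff_eq_mul, eq_comm]

end Reidemeister

/-- for a finite group `G` and endomorphism `φ`, `R(φ)` equals the number of
irreducible complex characters `χ` of `G` with `χ ∘ φ = χ`. -/
theorem stmt3 {G : Type} [Group G] [Finite G] (φ : G →* G) :
    reidemeisterNumber ⇑φ =
      Nat.card {χ : G → ℂ //
        (∃ V : FDRep ℂ G, CategoryTheory.Simple V ∧ FDRep.character V = χ) ∧ χ ∘ ⇑φ = χ} := by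
  classical
  have := Fintype.ofFinite G
  have := Fintype.ofFinite (IrrChar G)
  have hcard : Nat.card {χ : G → ℂ //
        (∃ V : FDRep ℂ G, CategoryTheory.Simple V ∧ FDRep.character V = χ) ∧ χ ∘ ⇑φ = χ} =
      (Finset.univ.filter fun χ : IrrChar G => χ.1 ∘ φ = χ.1).card := by
    rw [← Fintype.card_subtype, ← Nat.card_eq_fintype_card]
    exact Nat.card_congr (Equiv.subtypeSubtypeEquivSubtypeInter _ fun χ => χ ∘ ⇑φ = χ).symm
  have hG : (Nat.card G : ℂ) ≠ 0 := NeZero.ne _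
  rw [hcard, ← Nat.cast_inj (R := ℂ), ← mul_left_inj' hG]
  have hB := congrArg (Nat.cast : ℕ → ℂ) (reidemeisterNumber_mul_card φ)
  rw [Nat.cast_mul, Nat.cast_sum] at hB
  rw [hB]
  rw [Finset.sum_congr rfl fun γ _ => (IrrChar.sum_mul_inv (φ γ) γ).symm]
  rw [Finset.sum_comm]
  rw [Finset.sum_congr rfl fun χ _ => IrrChar.sum_comp_mul_inv χ φ]
  rw [← Finset.sum_filter, Finset.sum_const, nsmul_eq_mul]
end

section
/- Let G = ℤ^k × F with F a finite group, and let φ : G → G be an endomorphism with φ(F) ⊆ F, restriction φ^{finite} : F → F, and ℤ^k-component matrix M with det(I − M) ≠ 0. Then R(φ) = |det(I − M)| · #{irreducible complex characters χ of F such that χ ∘ φ^{finite} = χ}. -/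
theorem phiConj_equivalence {G : Type*} [Group G] (φ : G →* G) : Equivalence (phiConj φ) where
  refl a := ⟨1, by simp⟩
  symm := by
    rintro a _ ⟨γ, rfl⟩
    exact ⟨γ⁻¹, by simp [mul_assoc]⟩
  trans := by
    rintro a _ _ ⟨γ, rfl⟩ ⟨δ, rfl⟩
    exact ⟨δ * γ, by simp [mul_assoc]⟩

/-- Burnside's lemma for the action of a finite group on itself by `φ`-conjugation. -/
theorem sum_card_phiConj_fixed {F : Type*} [Group F] [Fintype F] (φ : F →* F) :
    ∑ g : F, Nat.card {a : F // g * a * (φ g)⁻¹ = a} = reidemeisterNumber φ * Nat.card F := by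
  classical
  let : MulAction F F :=
    { smul := fun g a => g * a * (φ g)⁻¹
      one_smul := fun a => by
        change 1 * a * (φ 1)⁻¹ = a
        simp
      mul_smul := fun g h a => by
        change g * h * a * (φ (g * h))⁻¹ = g * (h * a * (φ h)⁻¹) * (φ g)⁻¹
        simp [mul_assoc] }
  have h := MulAction.sum_card_fixedBy_eq_card_orbits_mul_card_group F F
  have e : Nat.card (Quotient (MulAction.orbitRel F F)) = reidemeisterNumber φ := by
    refine Nat.card_congr (Quot.congrRight fun a b => ?_)
    refine ⟨fun hab => ?_, fun hab => ?_⟩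
    · obtain ⟨γ, hγ⟩ := hab
      exact (phiConj_equivalence φ).symm ⟨γ, hγ.symm⟩
    · obtain ⟨γ, hγ⟩ := (phiConj_equivalence φ).symm hab
      exact ⟨γ, hγ.symm⟩
  rw [← e, Nat.card_eq_fintype_card, Nat.card_eq_fintype_card, ← h]
  refine Finset.sum_congr rfl fun g _ => ?_
  rw [← Nat.card_eq_fintype_card]
  rfl

/-- The cokernel of `1 - M` on `ℤ^k` has order `|det (1 - M)|`. -/
theorem card_quotient_range_one_sub {k : ℕ} (M : Matrix (Fin k) (Fin k) ℤ)
    (hdet : (1 - M).det ≠ 0) :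
    Nat.card ((Fin k → ℤ) ⧸ (1 - M).mulVecLin.range) = (1 - M).det.natAbs := by
  have hinj : Function.Injective (1 - M).mulVecLin :=
    (injective_iff_map_eq_zero _).2 fun _ hv => Matrix.eq_zero_of_mulVec_eq_zero hdet hv
  have h := Submodule.natAbs_det_equiv _ (LinearEquiv.ofInjective _ hinj)
  rw [← h]
  congr 1
  rw [← LinearMap.det_toLin']
  rfl

/-- The `φ`-conjugacy classes of `ℤ^k × F` split as a product over the cokernel of `1 - M`. -/
theorem reidemeisterNumber_prod (k : ℕ) {F : Type*} [Group F]
    (φ : Multiplicative (Fin k → ℤ) × F →* Multiplicative (Fin k → ℤ) × F)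
    (M : Matrix (Fin k) (Fin k) ℤ) (ψ : (Fin k → ℤ) → F) (φF : F →* F)
    (hφ : ∀ (v : Fin k → ℤ) (f : F),
      φ (Multiplicative.ofAdd v, f) = (Multiplicative.ofAdd (M.mulVec v), ψ v * φF f))
    (hdet : (1 - M).det ≠ 0) :
    reidemeisterNumber φ = (1 - M).det.natAbs * reidemeisterNumber φF := by
  have hψ : ψ 0 = 1 := by
    have h := hφ 0 1
    have h1 : ((Multiplicative.ofAdd (0 : Fin k → ℤ), (1 : F)) :
      Multiplicative (Fin k → ℤ) × F) = 1 := rfl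
    rw [h1, map_one] at h
    simpa using (congrArg Prod.snd h).symm
  have key (w w' : Fin k → ℤ) (a b : F) :
      phiConj φ (Multiplicative.ofAdd w, a) (Multiplicative.ofAdd w', b) ↔
        ∃ (v : Fin k → ℤ) (γ : F), w' = w + (1 - M).mulVec v ∧
          b = γ * a * (ψ v * φF γ)⁻¹ := by
    constructor
    · rintro ⟨⟨v, γ⟩, h⟩
      refine ⟨v.toAdd, γ, ?_, ?_⟩
      · have h1 := congrArg (fun x => x.1.toAdd) h
        have h2 := congrArg (fun x => x.1.toAdd) (hφ v.toAdd γ)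
        simp at h1 h2
        rw [h1, h2, Matrix.sub_mulVec, Matrix.one_mulVec]
        abel
      · have h1 := congrArg (fun x => x.2) h
        have h2 := congrArg (fun x => x.2) (hφ v.toAdd γ)
        simp at h1 h2
        rw [h1, h2, mul_inv_rev]
    · rintro ⟨v, γ, h1, h2⟩
      refine ⟨(Multiplicative.ofAdd v, γ), ?_⟩
      rw [hφ]
      refine Prod.ext ?_ h2
      simp only [h1, Matrix.sub_mulVec, Matrix.one_mulVec]
      apply Multiplicative.toAdd.injective
      simp
      abel
  have hinj (v : Fin k → ℤ) (hv : (1 - M).mulVec v = 0) : v = 0 :=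
    Matrix.eq_zero_of_mulVec_eq_zero hdet hv
  rw [← card_quotient_range_one_sub M hdet, reidemeisterNumber, reidemeisterNumber, ← Nat.card_prod]
  symm
  let N := (1 - M).mulVecLin.range
  let r (q : (Fin k → ℤ) ⧸ N) : Fin k → ℤ := q.out
  let g : ((Fin k → ℤ) ⧸ N) × Quot (phiConj φF) → Quot (phiConj φ) := fun x =>
    Quot.lift (fun a => Quot.mk (phiConj φ) (Multiplicative.ofAdd (r x.1), a))
      (fun a b ⟨γ, hγ⟩ => Quot.sound ((key _ _ _ _).2 ⟨0, γ, by simp, by simp [hψ, hγ]⟩)) x.2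
  refine Nat.card_congr (Equiv.ofBijective g ⟨?_, ?_⟩)
  · rintro ⟨q, ⟨a⟩⟩ ⟨q', ⟨b⟩⟩ h
    obtain ⟨v, γ, h1, h2⟩ := (key _ _ _ _).1 (((phiConj_equivalence φ).quot_mk_eq_iff _ _).1 h)
    have hq : q = q' := by
      rw [← Submodule.Quotient.mk_out q, ← Submodule.Quotient.mk_out q', eq_comm,
        Submodule.Quotient.eq]
      exact ⟨v, by rw [Matrix.mulVecLin_apply, eq_sub_iff_add_eq, add_comm]; exact h1.symm⟩
    subst hq
    have hv : v = 0 := hinj v (by simpa using h1)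
    subst hv
    refine Prod.ext rfl (Quot.sound ⟨γ, ?_⟩)
    simpa [hψ] using h2
  · rintro ⟨⟨w, a⟩⟩
    obtain ⟨v, hv⟩ : w.toAdd - r (Submodule.Quotient.mk w.toAdd) ∈ N := by
      rw [← Submodule.Quotient.eq]
      exact (Submodule.Quotient.mk_out _).symm
    refine ⟨(Submodule.Quotient.mk w.toAdd, Quot.mk _ (a * ψ v)), ?_⟩
    refine Quot.sound ((key _ w.toAdd _ _).2 ⟨v, 1, ?_, ?_⟩)
    · rw [Matrix.mulVecLin_apply] at hv
      rw [hv]; abel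
    · simp

section

open MonoidAlgebra Representation

variable {k G M : Type*} [Field k] [Monoid G] [AddCommGroup M] [Module k M] [Module k[G] M]
  [IsScalarTower k k[G] M]

theorem asAlgebraHom_ofModule' (r : k[G]) :
    (ofModule' (k := k) (G := G) M).asAlgebraHom r = Algebra.lsmul k k M r :=
  DFunLike.congr_fun ((MonoidAlgebra.lift k (M →ₗ[k] M) G).apply_symm_apply (Algebra.lsmul k k M)) r

theorem isIrreducible_ofModule' [IsSimpleModule k[G] M] :
    (ofModule' (k := k) (G := G) M).IsIrreducible := by
  let e : (ofModule' (k := k) (G := G) M).asModule ≃ₗ[k[G]] M :=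
    { (asModuleEquiv _).toAddEquiv with
      map_smul' := fun r x => (asModuleEquiv_map_smul _ r x).trans
        (LinearMap.congr_fun (asAlgebraHom_ofModule' r) _) }
  exact (irreducible_iff_isSimpleModule_asModule _).2 (IsSimpleModule.congr e)

end

open CategoryTheory in
theorem FDRep.injective_of_mono {k G : Type} [Field k] [Monoid G] {V W : FDRep k G} (f : V ⟶ W)
    [Mono f] : Function.Injective ((forget₂ (FDRep k G) (Rep k G)).map f).hom :=
  (Rep.mono_iff_injective _).1 inferInstance

section

variable {F : Type} [Group F]

/-- The set of irreducible complex characters of `F`. -/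
def irreducibleCharacters (F : Type) [Group F] : Set (F → ℂ) :=
  {χ | ∃ V : FDRep ℂ F, CategoryTheory.Simple V ∧ V.character = χ}

theorem apply_conj_of_mem_irreducibleCharacters {χ : F → ℂ} (h : χ ∈ irreducibleCharacters F)
    (g x : F) : χ (x * g * x⁻¹) = χ g := by
  obtain ⟨V, -, rfl⟩ := h
  exact V.char_conj g x

variable [Fintype F]

open CategoryTheory in
open scoped Classical in
theorem irreducibleCharacters_orthonormal {χ η : F → ℂ}
    (hχ : χ ∈ irreducibleCharacters F) (hη : η ∈ irreducibleCharacters F) :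
    (Nat.card F : ℂ)⁻¹ * ∑ g : F, χ g * η g⁻¹ = if χ = η then 1 else 0 := by
  obtain ⟨V, hV, rfl⟩ := hχ
  obtain ⟨W, hW, rfl⟩ := hη
  have := invertibleOfNonzero (NeZero.ne (Nat.card F : ℂ))
  by_cases h : V.character = W.character
  · rw [h, FDRep.char_orthonormal, if_pos ⟨Iso.refl W⟩, if_pos rfl]
  · rw [FDRep.char_orthonormal, if_neg fun ⟨i⟩ => h (FDRep.char_iso i), if_neg h]

open CategoryTheory in
open scoped Classical in
/-- The multiplicity of an irreducible character `χ` in its pullback `χ ∘ φ`: since both have the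
same degree, it is nonzero only if they agree. -/
theorem irreducibleCharacters_comp_inner {χ : F → ℂ} (hχ : χ ∈ irreducibleCharacters F)
    (φ : F →* F) :
    (Nat.card F : ℂ)⁻¹ * ∑ g : F, χ (φ g) * χ g⁻¹ = if χ ∘ φ = χ then 1 else 0 := by
  split_ifs with h
  · simp_rw [fun g => show χ (φ g) = χ g from congrFun h g]
    simpa using irreducibleCharacters_orthonormal hχ hχ
  · obtain ⟨V, hV, rfl⟩ := hχ
    have := invertibleOfNonzero (NeZero.ne (Nat.card F : ℂ))
    let W : FDRep ℂ F := FDRep.of (V.ρ.comp φ)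
    have hW : W.character = V.character ∘ φ := rfl
    refine (FDRep.scalar_product_char_eq_finrank_equivariant V W).trans ?_
    by_contra h0
    obtain ⟨f, hf⟩ : ∃ f : V ⟶ W, f ≠ 0 := by
      by_contra! h1
      have : Subsingleton (V ⟶ W) := ⟨fun a b => (h1 a).trans (h1 b).symm⟩
      exact h0 (by simp [Module.finrank_zero_of_subsingleton])
    have : Mono f := mono_of_nonzero_from_simple hf
    have hinj := FDRep.injective_of_mono f
    let f' := ((forget₂ (FDRep ℂ F) (Rep ℂ F)).map f).hom
    let e : V ≃ₗ[ℂ] W := LinearEquiv.ofInjectiveOfFinrankEq f'.toLinearMap hinj rfl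
    refine h (funext fun g => ?_)
    have hconj : W.ρ g = e.conj (V.ρ g) := by
      ext w
      obtain ⟨v, rfl⟩ := e.surjective w
      rw [LinearEquiv.conj_apply_apply, LinearEquiv.symm_apply_apply]
      exact (Representation.IntertwiningMap.isIntertwining _ _ f' g v).symm
    change LinearMap.trace ℂ W (W.ρ g) = LinearMap.trace ℂ V (V.ρ g)
    rw [hconj, LinearMap.trace_conj']

theorem character_mem_irreducibleCharacters {V : Type} [AddCommGroup V] [Module ℂ V]
    [FiniteDimensional ℂ V] (ρ : Representation ℂ F V) [ρ.IsIrreducible] :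
    ρ.character ∈ irreducibleCharacters F := by
  have := invertibleOfNonzero (NeZero.ne (Nat.card F : ℂ))
  refine ⟨FDRep.of ρ, (FDRep.simple_iff_char_is_norm_one _).2 ?_, rfl⟩
  have h := ρ.card_inv_mul_sum_char_mul_char_eq_finrank ρ
  rw [Representation.IsIrreducible.finrank_intertwiningMap_self, Nat.cast_one,
    inv_mul_eq_one₀ (NeZero.ne _)] at h
  exact h.symm

/-- A class function acts by zero on every irreducible representation whose character is
orthogonal to it. -/
theorem sum_smul_eq_zero_of_orthogonal {V : Type} [AddCommGroup V] [Module ℂ V]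
    [FiniteDimensional ℂ V] (ρ : Representation ℂ F V) [ρ.IsIrreducible] {f : F → ℂ}
    (hf : ∀ g x, f (x * g * x⁻¹) = f g) (h : ∑ g, f g * ρ.character g⁻¹ = 0) :
    ∑ g, f g • ρ g⁻¹ = 0 := by
  let T : V →ₗ[ℂ] V := ∑ g, f g • ρ g⁻¹
  have hT (x : F) : T ∘ₗ ρ x = ρ x ∘ₗ T := by
    change T * ρ x = ρ x * T
    simp only [T, Finset.sum_mul, Finset.mul_sum, smul_mul_assoc, mul_smul_comm, ← map_mul]
    refine Fintype.sum_equiv (MulAut.conj x⁻¹).toEquiv _ _ fun g => ?_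
    have := hf g x⁻¹
    simp only [inv_inv, mul_assoc] at this
    simp [this, mul_assoc, -map_mul]
  let T' : ρ.IntertwiningMap ρ := ⟨T, hT⟩
  obtain ⟨c, hc⟩ :=
    (Representation.IsIrreducible.algebraMap_intertwiningMap_bijective_of_isAlgClosed
      (ρ := ρ) (k := ℂ)).2 T'
  have hcT : T = c • LinearMap.id := by
    ext v
    exact (congrArg (fun t : ρ.IntertwiningMap ρ => t v) hc).symm
  have htr : LinearMap.trace ℂ V T = 0 := by
    simpa [T, Representation.character] using h
  rw [hcT, map_smul, LinearMap.trace_id, smul_eq_mul, mul_eq_zero] at htr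
  change T = 0
  rw [hcT]
  rcases htr with hc0 | hd
  · rw [hc0, zero_smul]
  · have := Module.finrank_zero_iff.1 (Nat.cast_eq_zero.1 hd)
    ext v
    exact Subsingleton.elim _ _

open MonoidAlgebra in
/-- Irreducible characters are complete: a class function orthogonal to all of them vanishes. -/
theorem classFunction_eq_zero_of_orthogonal {f : F → ℂ} (hf : ∀ g x, f (x * g * x⁻¹) = f g)
    (h : ∀ χ ∈ irreducibleCharacters F, ∑ g, f g * χ g⁻¹ = 0) : f = 0 := by
  let z : ℂ[F] := ∑ g, single g⁻¹ (f g)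
  suffices hz : z = 0 by
    funext g
    have := congrArg (fun y : ℂ[F] => y.coeff g⁻¹) hz
    classical simpa [z, Finsupp.single_apply] using this
  have : z ∈ Ring.jacobson ℂ[F] := by
    rw [Ring.jacobson_eq_sInf_isMaximal, Submodule.mem_sInf]
    intro I (hI : Ideal.IsMaximal I)
    have : IsSimpleModule ℂ[F] (ℂ[F] ⧸ I) := isSimpleModule_iff_isCoatom.2 hI.out
    let ρ := Representation.ofModule' (k := ℂ) (G := F) (ℂ[F] ⧸ I)
    have : ρ.IsIrreducible := isIrreducible_ofModule'
    have : FiniteDimensional ℂ (ℂ[F] ⧸ I) := Module.Finite.trans ℂ[F] _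
    have h0 := sum_smul_eq_zero_of_orthogonal ρ hf (h _ (character_mem_irreducibleCharacters ρ))
    have h1 : ρ.asAlgebraHom z = ∑ g, f g • ρ g⁻¹ := by simp [z]
    have h2 := LinearMap.congr_fun (asAlgebraHom_ofModule' (M := ℂ[F] ⧸ I) z)
      (Submodule.Quotient.mk 1)
    rw [h1, h0, LinearMap.zero_apply, Algebra.lsmul_coe] at h2
    beta_reduce at h2
    rw [← Submodule.Quotient.mk_smul, smul_eq_mul, mul_one, eq_comm,
      Submodule.Quotient.mk_eq_zero] at h2
    exact h2
  rwa [IsSemisimpleRing.jacobson_eq_bot, Submodule.mem_bot] at this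

theorem linearIndependent_irreducibleCharacters :
    LinearIndependent ℂ ((↑) : irreducibleCharacters F → F → ℂ) := by
  classical
  rw [linearIndependent_iff']
  intro s c hc i hi
  have h : ∑ j ∈ s, c j * ((Nat.card F : ℂ)⁻¹ * ∑ g, j.1 g * i.1 g⁻¹) = 0 := by
    have h2 := congrArg (fun f : F → ℂ => (Nat.card F : ℂ)⁻¹ * ∑ g, f g * i.1 g⁻¹) hc
    simp only [Finset.sum_apply, Pi.smul_apply, smul_eq_mul, Pi.zero_apply, zero_mul,
      Finset.sum_const_zero, mul_zero] at h2
    rw [← h2]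
    simp only [Finset.sum_mul, Finset.mul_sum]
    rw [Finset.sum_comm]
    refine Finset.sum_congr rfl fun g _ => Finset.sum_congr rfl fun j _ => by ring
  simp_rw [fun j : irreducibleCharacters F => irreducibleCharacters_orthonormal j.2 i.2] at h
  simpa [Subtype.coe_inj, hi] using h

instance : Finite (irreducibleCharacters F) :=
  linearIndependent_irreducibleCharacters.finite

/-- Column orthogonality of the irreducible characters. -/
theorem sum_irreducibleCharacters_mul [Fintype (irreducibleCharacters F)] (g h : F) :
    ∑ χ : irreducibleCharacters F, χ.1 h * χ.1 g⁻¹ = Nat.card {a : F // g * a * h⁻¹ = a} := by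
  classical
  let f (x : F) : ℂ := ∑ a : F, if a * x * a⁻¹ = g then 1 else 0
  have hf (x y : F) : f (y * x * y⁻¹) = f x :=
    Fintype.sum_equiv (Equiv.mulRight y) _ _ fun a => by simp [mul_assoc]
  have hfχ {χ : F → ℂ} (hχ : χ ∈ irreducibleCharacters F) :
      ∑ x, f x * χ x⁻¹ = Nat.card F * χ g⁻¹ := by
    simp only [f, Finset.sum_mul]
    rw [Finset.sum_comm]
    have (a : F) : ∑ x, (if a * x * a⁻¹ = g then (1 : ℂ) else 0) * χ x⁻¹ = χ g⁻¹ := by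
      rw [Fintype.sum_eq_single (a⁻¹ * g * a)]
      · have := apply_conj_of_mem_irreducibleCharacters hχ g⁻¹ a⁻¹
        simp [mul_assoc] at this ⊢
        exact this
      · intro x hx
        rw [if_neg, zero_mul]
        rintro rfl
        simp [mul_assoc] at hx
    rw [Finset.sum_congr rfl fun a _ => this a]
    simp
  have key : f - ∑ χ : irreducibleCharacters F, χ.1 g⁻¹ • χ.1 = 0 := by
    refine classFunction_eq_zero_of_orthogonal (fun x y => ?_) fun η hη => ?_
    · simp [hf, fun χ : irreducibleCharacters F =>
        apply_conj_of_mem_irreducibleCharacters χ.2 x y]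
    · have hN : (Nat.card F : ℂ) ≠ 0 := NeZero.ne _
      have horth (χ : irreducibleCharacters F) :
          ∑ x, χ.1 x * η x⁻¹ = if χ = ⟨η, hη⟩ then (Nat.card F : ℂ) else 0 := by
        have := irreducibleCharacters_orthonormal χ.2 hη
        rw [inv_mul_eq_iff_eq_mul₀ hN] at this
        simpa [Subtype.ext_iff] using this
      simp only [Pi.sub_apply, Finset.sum_apply, Pi.smul_apply, smul_eq_mul, sub_mul,
        Finset.sum_sub_distrib, hfχ hη, Finset.sum_mul, mul_assoc]
      rw [Finset.sum_comm]
      simp only [← Finset.mul_sum, horth]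
      simp [mul_comm]
  have := congrFun (sub_eq_zero.1 key) h
  simp only [f, Finset.sum_apply, Pi.smul_apply, smul_eq_mul] at this
  simp_rw [fun χ : irreducibleCharacters F => mul_comm (χ.1 h) (χ.1 g⁻¹), ← this, Finset.sum_boole,
    Nat.card_eq_fintype_card,
    Fintype.card_subtype]
  norm_cast
  refine congrArg Finset.card (Finset.filter_congr fun a _ => ?_)
  rw [mul_inv_eq_iff_eq_mul, mul_inv_eq_iff_eq_mul, eq_comm]

/-- The Reidemeister number of an endomorphism of a finite group is the number of irreducible
characters it fixes. -/
theorem reidemeisterNumber_eq_card_fixed_irreducibleCharacters (φ : F →* F) :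
    reidemeisterNumber φ = Nat.card {χ : F → ℂ // χ ∈ irreducibleCharacters F ∧ χ ∘ φ = χ} := by
  classical
  have := Fintype.ofFinite (irreducibleCharacters F)
  have hN : (Nat.card F : ℂ) ≠ 0 := NeZero.ne _
  have h := congrArg (Nat.cast : ℕ → ℂ) (sum_card_phiConj_fixed φ)
  push_cast at h
  simp_rw [← sum_irreducibleCharacters_mul] at h
  rw [Finset.sum_comm, mul_comm, ← inv_mul_eq_iff_eq_mul₀ hN, Finset.mul_sum] at h
  simp_rw [fun χ : irreducibleCharacters F => irreducibleCharacters_comp_inner χ.2 φ,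
    Finset.sum_boole] at h
  rw [← Nat.cast_injective h, ← Fintype.card_subtype, ← Nat.card_eq_fintype_card]
  exact Nat.card_congr (Equiv.subtypeSubtypeEquivSubtypeInter _ (fun χ : F → ℂ => χ ∘ φ = χ))

end

/-- for `G = ℤ^k × F` (`F` finite) and an endomorphism `φ` with
`φ(v,f) = (M·v, ψ(v)·φ^finite(f))` and `det(I - M) ≠ 0`,
`R(φ) = |det(I - M)| · #{irreducible complex characters χ of F with χ ∘ φ^finite = χ}`. -/
theorem stmt10 (k : ℕ) {F : Type} [Group F] [Finite F]
    (φ : Multiplicative (Fin k → ℤ) × F →* Multiplicative (Fin k → ℤ) × F)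
    (M : Matrix (Fin k) (Fin k) ℤ) (ψ : (Fin k → ℤ) → F) (φF : F →* F)
    (hφ : ∀ (v : Fin k → ℤ) (f : F),
      φ (Multiplicative.ofAdd v, f) = (Multiplicative.ofAdd (M.mulVec v), ψ v * φF f))
    (hdet : (1 - M).det ≠ 0) :
    reidemeisterNumber ⇑φ =
      (1 - M).det.natAbs *
        Nat.card {χ : F → ℂ //
          (∃ V : FDRep ℂ F, CategoryTheory.Simple V ∧ FDRep.character V = χ) ∧ χ ∘ ⇑φF = χ} := by
  have := Fintype.ofFinite F
  rw [reidemeisterNumber_prod k φ M ψ φF hφ hdet,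
    reidemeisterNumber_eq_card_fixed_irreducibleCharacters]
  rfl
end
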